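/- arXiv:2604.07515 — 2 statements merged into one kernel-verified Lean document; each statement's English description precedes it below -/
import Mathlib

section
/- For any finite simple graph G=(V,E) on n vertices, any V^? ⊆ V and E^? ⊆ E, and a permutation π drawn uniformly at random from all permutations of V, the expected size of the influence set satisfies E[|InfluenceMIS(G, V^?, E^?, 1)|] ≤ |V^?| + |E^?|. -/
open Finset

/-- `lfmisAux W E π i` : the vertex at π-position `i` is in the greedy
lexicographically-first MIS of the graph with vertex set `W` and edge set `E`. -/
def lfmisAux {n : ℕ} (W : Set (Fin n)) (E : Set (Sym2 (Fin n))) (π : Equiv.Perm (Fin n))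
    (i : ℕ) : Prop :=
  (∃ h : i < n, π ⟨i, h⟩ ∈ W) ∧
    ∀ j, j < i →
      (∃ (h1 : j < n) (h2 : i < n), π ⟨j, h1⟩ ∈ W ∧ π ⟨i, h2⟩ ∈ W ∧
        s(π ⟨j, h1⟩, π ⟨i, h2⟩) ∈ E) → ¬ lfmisAux W E π j
termination_by i

/-- The lexicographically-first MIS of the graph with vertex set `W ⊆ Fin n`
and edge set `E`, under the permutation `π` (position `i` holds vertex `π i`). -/
def LFMISOn {n : ℕ} (W : Set (Fin n)) (E : Set (Sym2 (Fin n)))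
    (π : Equiv.Perm (Fin n)) : Set (Fin n) :=
  {v | v ∈ W ∧ lfmisAux W E π (π.symm v : ℕ)}

/-- State of the `InfluenceMIS` procedure: alive vertices, surviving edges,
undecided vertices, undecided edges. -/
structure MISState (n : ℕ) where
  verts : Finset (Fin n)
  edges : Finset (Sym2 (Fin n))
  uV : Finset (Fin n)
  uE : Finset (Sym2 (Fin n))

/-- Current neighbors of `u`. -/
def MISState.nbrs {n : ℕ} (st : MISState n) (u : Fin n) : Finset (Fin n) :=
  st.verts.filter fun v => v ≠ u ∧ s(u, v) ∈ st.edges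

/-- One iteration of `InfluenceMIS`, processing vertex `u`.  If `u` is not alive,
nothing happens.  If `u` is undecided, all of its neighbors become undecided and
`u` is deleted (it joins the influence set).  Otherwise `u` is (implicitly) added
to the MIS: its neighbors along undecided edges become undecided, its neighbors
along decided edges are deleted, and `u` is deleted. -/
def stepInf {n : ℕ} (st : MISState n) (u : Fin n) : MISState n :=
  if u ∉ st.verts then st
  else if u ∈ st.uV then
    { verts := st.verts.erase u
      edges := st.edges.filter fun e => u ∉ e
      uV := (st.uV ∪ st.nbrs u).erase u
      uE := st.uE.filter fun e => u ∉ e }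
  else
    let D := (st.nbrs u).filter fun v => s(u, v) ∉ st.uE
    let U := (st.nbrs u).filter fun v => s(u, v) ∈ st.uE
    { verts := (st.verts.erase u) \ D
      edges := st.edges.filter fun e => u ∉ e ∧ ∀ v ∈ D, v ∉ e
      uV := ((st.uV ∪ U) \ D).erase u
      uE := st.uE.filter fun e => u ∉ e ∧ ∀ v ∈ D, v ∉ e }

/-- `stateAt π st0 i` : the state at the beginning of (0-based) iteration `i`
of `InfluenceMIS` started from `st0`, where position `i` holds vertex `π i`
(so 1-based iteration `i` of the paper corresponds to `stateAt π st0 (i-1)`). -/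
def stateAt {n : ℕ} (π : Equiv.Perm (Fin n)) (st0 : MISState n) : ℕ → MISState n
  | 0 => st0
  | i + 1 => if h : i < n then stepInf (stateAt π st0 i) (π ⟨i, h⟩) else stateAt π st0 i

/-- The influence set returned by `InfluenceMIS`: vertices that are alive and
undecided at the beginning of their own iteration. -/
def influenceMIS {n : ℕ} (π : Equiv.Perm (Fin n)) (st0 : MISState n) : Finset (Fin n) :=
  Finset.univ.filter fun v =>
    v ∈ (stateAt π st0 (π.symm v : ℕ)).verts ∧ v ∈ (stateAt π st0 (π.symm v : ℕ)).uV

/-- Initial state of `InfluenceMIS` on a graph `G` with undecided vertices `uV`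
and undecided edges `uE`. -/
def initState {n : ℕ} (G : SimpleGraph (Fin n)) [DecidableRel G.Adj]
    (uV : Finset (Fin n)) (uE : Finset (Sym2 (Fin n))) : MISState n :=
  ⟨Finset.univ, G.edgeFinset, uV, uE⟩

/-- The number of undecided vertices and edges of a state. -/
def MISState.potential {n : ℕ} (st : MISState n) : ℤ :=
  (st.uV.card : ℤ) + st.uE.card

/-- The change of the potential when `u` is processed, plus one if `u` joins the influence set. -/
def MISState.drift {n : ℕ} (st : MISState n) (u : Fin n) : ℤ :=
  (if u ∈ st.verts ∧ u ∈ st.uV then 1 else 0) + (stepInf st u).potential - st.potential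

namespace MISState

variable {n : ℕ} (st : MISState n)

theorem mem_nbrs_comm {u v : Fin n} (hu : u ∈ st.verts) (hv : v ∈ st.verts) :
    v ∈ st.nbrs u ↔ u ∈ st.nbrs v := by
  simp [nbrs, hu, hv, Sym2.eq_swap (a := u), ne_comm]

theorem drift_of_notMem {u : Fin n} (hu : u ∉ st.verts) : st.drift u = 0 := by
  simp [drift, stepInf, hu]

theorem drift_le_of_mem {u : Fin n} (hu : u ∈ st.verts) (hq : u ∈ st.uV) :
    st.drift u ≤ ((st.nbrs u).filter (· ∉ st.uV)).card := by
  have h1 : ((st.uV ∪ st.nbrs u).erase u).card + 1 = (st.uV ∪ st.nbrs u).card :=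
    card_erase_add_one (mem_union_left _ hq)
  have h2 : (st.uV ∪ st.nbrs u).card = st.uV.card + ((st.nbrs u).filter (· ∉ st.uV)).card := by
    rw [filter_notMem_eq_sdiff, ← union_sdiff_self_eq_union,
      card_union_of_disjoint disjoint_sdiff]
  have h3 : (st.uE.filter fun e => u ∉ e).card ≤ st.uE.card := card_filter_le _ _
  simp only [drift, stepInf, potential, hu, hq, not_true_eq_false, if_true, if_false, and_self]
  omega

theorem drift_le_of_notMem {u : Fin n} (hu : u ∈ st.verts) (hq : u ∉ st.uV) :
    st.drift u ≤ -(((st.nbrs u).filter (· ∈ st.uV)).card : ℤ) := by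
  simp only [drift, stepInf, potential, hu, hq, not_true_eq_false, if_false, and_false]
  set N := st.nbrs u
  set D := N.filter fun v => s(u, v) ∉ st.uE
  set U := N.filter fun v => s(u, v) ∈ st.uE
  have hV : (((st.uV ∪ U) \ D).erase u).card + (D.filter (· ∈ st.uV)).card
      ≤ st.uV.card + (U.filter (· ∉ st.uV)).card := by
    have hsub : ((st.uV ∪ U) \ D).erase u ⊆ (st.uV \ D) ∪ U.filter (· ∉ st.uV) := by
      intro x
      simp only [mem_erase, mem_sdiff, mem_union, mem_filter]
      tauto
    have h1 := (card_le_card hsub).trans (card_union_le _ _)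
    have h2 := card_sdiff_add_card_inter st.uV D
    have h3 : st.uV ∩ D = D.filter (· ∈ st.uV) := by
      ext x
      simp [and_comm]
    rw [h3] at h2
    omega
  have hE : (st.uE.filter fun e => u ∉ e ∧ ∀ v ∈ D, v ∉ e).card + U.card ≤ st.uE.card := by
    have himg : (U.image fun v => s(u, v)).card = U.card :=
      card_image_of_injective _ fun _ _ h => Sym2.congr_right.1 h
    rw [← himg, ← card_union_of_disjoint]
    · refine card_le_card (union_subset (filter_subset _ _) fun e he => ?_)
      obtain ⟨v, hv, rfl⟩ := mem_image.1 he
      exact (mem_filter.1 hv).2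
    · rw [disjoint_left]
      intro e he he'
      obtain ⟨v, hv, rfl⟩ := mem_image.1 he'
      exact (mem_filter.1 he).2.1 (Sym2.mem_mk_left u v)
  have hU := card_filter_add_card_filter_not (s := U) (· ∈ st.uV)
  have hN : (N.filter (· ∈ st.uV)).card
      = (U.filter (· ∈ st.uV)).card + (D.filter (· ∈ st.uV)).card := by
    rw [filter_comm, filter_comm (fun v => s(u, v) ∉ st.uE)]
    exact (card_filter_add_card_filter_not _).symm
  omega

theorem sum_drift_nonpos : ∑ u, st.drift u ≤ 0 := by
  set A := st.verts.filter (· ∈ st.uV)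
  set B := st.verts.filter (· ∉ st.uV)
  have hcount : ∑ u ∈ A, ((st.nbrs u).filter (· ∉ st.uV)).card
      = ∑ u ∈ B, ((st.nbrs u).filter (· ∈ st.uV)).card := by
    have hA : ∀ u ∈ A, (st.nbrs u).filter (· ∉ st.uV)
        = bipartiteAbove (fun a b => b ∈ st.nbrs a) B u := by
      intro u _
      ext v
      simp only [bipartiteAbove, B, nbrs, mem_filter]
      tauto
    have hB : ∀ v ∈ B, (st.nbrs v).filter (· ∈ st.uV)
        = bipartiteBelow (fun a b => b ∈ st.nbrs a) A v := by
      intro v hv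
      ext u
      have hv' := (mem_filter.1 hv).1
      have hmem : u ∈ st.nbrs v → u ∈ st.verts := fun h => (mem_filter.1 h).1
      have hcomm : u ∈ st.verts → (v ∈ st.nbrs u ↔ u ∈ st.nbrs v) :=
        fun h => st.mem_nbrs_comm h hv'
      simp only [bipartiteBelow, A, mem_filter]
      tauto
    rw [sum_congr rfl fun u hu => congrArg card (hA u hu),
      sum_congr rfl fun u hu => congrArg card (hB u hu)]
    exact sum_card_bipartiteAbove_eq_sum_card_bipartiteBelow _
  have hsum : ∑ u, st.drift u = ∑ u ∈ A, st.drift u + ∑ u ∈ B, st.drift u := by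
    rw [sum_filter_add_sum_filter_not]
    exact (sum_subset (subset_univ _) fun u _ hu => st.drift_of_notMem hu).symm
  have h1 : ∑ u ∈ A, st.drift u ≤ ∑ u ∈ A, (((st.nbrs u).filter (· ∉ st.uV)).card : ℤ) :=
    sum_le_sum fun u hu => st.drift_le_of_mem (mem_filter.1 hu).1 (mem_filter.1 hu).2
  have h2 : ∑ u ∈ B, st.drift u ≤ ∑ u ∈ B, -(((st.nbrs u).filter (· ∈ st.uV)).card : ℤ) :=
    sum_le_sum fun u hu => st.drift_le_of_notMem (mem_filter.1 hu).1 (mem_filter.1 hu).2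
  have h3 : ∑ u ∈ A, (((st.nbrs u).filter (· ∉ st.uV)).card : ℤ)
      = ∑ u ∈ B, (((st.nbrs u).filter (· ∈ st.uV)).card : ℤ) := mod_cast hcount
  rw [sum_neg_distrib] at h2
  linarith

end MISState

theorem stepInf_verts_subset {n : ℕ} (st : MISState n) (u : Fin n) :
    (stepInf st u).verts ⊆ st.verts.erase u := by
  unfold stepInf
  split_ifs with h1 h2
  · exact Subset.rfl
  · exact sdiff_subset
  · rw [erase_eq_of_notMem h1]

theorem stateAt_succ {n : ℕ} (π : Equiv.Perm (Fin n)) (st0 : MISState n) (i : Fin n) :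
    stateAt π st0 (i + 1) = stepInf (stateAt π st0 i) (π i) := by
  simp [stateAt]

theorem notMem_verts_stateAt {n : ℕ} (π : Equiv.Perm (Fin n)) (st0 : MISState n)
    (j : Fin n) (i : ℕ) (hij : (j : ℕ) < i) : π j ∉ (stateAt π st0 i).verts := by
  induction i with
  | zero => omega
  | succ i ih =>
    by_cases hi : i < n
    · intro hmem
      rw [stateAt, dif_pos hi] at hmem
      have hmem' := mem_erase.1 (stepInf_verts_subset _ _ hmem)
      rcases Nat.lt_succ_iff_lt_or_eq.1 hij with h | h
      · exact ih h hmem'.2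
      · subst h
        exact hmem'.1 rfl
    · rw [stateAt, dif_neg hi]
      exact ih (j.2.trans_le (not_lt.1 hi))

theorem stateAt_congr {n : ℕ} {π σ : Equiv.Perm (Fin n)} (st0 : MISState n) (i : ℕ)
    (h : ∀ j : Fin n, (j : ℕ) < i → π j = σ j) : stateAt π st0 i = stateAt σ st0 i := by
  induction i with
  | zero => rfl
  | succ i ih =>
    rw [stateAt, stateAt, ih fun j hj => h j (hj.trans i.lt_succ_self)]
    split_ifs with hi
    · rw [h ⟨i, hi⟩ i.lt_succ_self]
    · rfl

/-- The not yet processed positions are exchangeable. -/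
theorem sum_drift_stateAt_eq {n : ℕ} (st0 : MISState n) {i k : Fin n} (hik : i ≤ k) :
    ∑ π : Equiv.Perm (Fin n), (stateAt π st0 i).drift (π k)
      = ∑ π : Equiv.Perm (Fin n), (stateAt π st0 i).drift (π i) := by
  rw [← Equiv.sum_comp (Equiv.mulRight (Equiv.swap i k))]
  refine sum_congr rfl fun π _ => ?_
  have hstate : stateAt (π * Equiv.swap i k) st0 i = stateAt π st0 i := by
    refine stateAt_congr st0 i fun j hj => ?_
    rw [Equiv.Perm.mul_apply,
      Equiv.swap_apply_of_ne_of_ne (Fin.ne_of_lt hj) (Fin.ne_of_lt (hj.trans_le hik))]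
  simp [hstate]

theorem sum_drift_stateAt_nonpos {n : ℕ} (st0 : MISState n) (i : Fin n) :
    ∑ π : Equiv.Perm (Fin n), (stateAt π st0 i).drift (π i) ≤ 0 := by
  have hpos : 0 < ((Ici i).card : ℤ) := mod_cast card_pos.2 ⟨i, mem_Ici.2 le_rfl⟩
  refine nonpos_of_mul_nonpos_right (a := ((Ici i).card : ℤ)) ?_ hpos
  calc ((Ici i).card : ℤ) * ∑ π : Equiv.Perm (Fin n), (stateAt π st0 i).drift (π i)
      = ∑ k ∈ Ici i, ∑ π : Equiv.Perm (Fin n), (stateAt π st0 i).drift (π k) := by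
        rw [sum_congr rfl fun k hk => sum_drift_stateAt_eq st0 (mem_Ici.1 hk), sum_const,
          nsmul_eq_mul]
    _ = ∑ π : Equiv.Perm (Fin n), ∑ k ∈ Ici i, (stateAt π st0 i).drift (π k) := sum_comm
    _ ≤ 0 := sum_nonpos fun π _ => by
        rw [sum_subset (subset_univ (Ici i)) fun k _ hk =>
          MISState.drift_of_notMem _ (notMem_verts_stateAt π st0 k i
            (not_le.1 fun h => hk (mem_Ici.2 h))),
          Equiv.sum_comp π]
        exact MISState.sum_drift_nonpos _

theorem card_influenceMIS_eq {n : ℕ} (π : Equiv.Perm (Fin n)) (st0 : MISState n) :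
    ((influenceMIS π st0).card : ℤ) = st0.potential - (stateAt π st0 n).potential
      + ∑ i : Fin n, (stateAt π st0 i).drift (π i) := by
  have hcard : ((influenceMIS π st0).card : ℤ) = ∑ i : Fin n,
      if π i ∈ (stateAt π st0 i).verts ∧ π i ∈ (stateAt π st0 i).uV then 1 else 0 := by
    rw [influenceMIS, card_filter, Nat.cast_sum, ← Equiv.sum_comp π]
    simp
  have htel : ∑ i : Fin n, ((stateAt π st0 (i + 1)).potential - (stateAt π st0 i).potential)
      = (stateAt π st0 n).potential - st0.potential := by
    rw [Fin.sum_univ_eq_sum_range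
      (fun i => (stateAt π st0 (i + 1)).potential - (stateAt π st0 i).potential),
      sum_range_sub fun i => (stateAt π st0 i).potential]
    rfl
  simp only [MISState.drift, add_sub_assoc, ← stateAt_succ]
  rw [sum_add_distrib, htel, hcard]
  ring

/-- For a uniformly random permutation, the expected size of the influence set
of `InfluenceMIS(G, V?, E?, 1)` is at most `|V?| + |E?|`
(stated as: the sum over all permutations is at most `n! · (|V?| + |E?|)`). -/
theorem expected_influence_le {n : ℕ} (G : SimpleGraph (Fin n)) [DecidableRel G.Adj]
    (uV : Finset (Fin n)) (uE : Finset (Sym2 (Fin n))) (huE : uE ⊆ G.edgeFinset) :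
    ∑ π : Equiv.Perm (Fin n), (influenceMIS π (initState G uV uE)).card
      ≤ Fintype.card (Equiv.Perm (Fin n)) * (uV.card + uE.card) := by
  set st0 := initState G uV uE
  have hdrift : ∑ π : Equiv.Perm (Fin n), ∑ i : Fin n, (stateAt π st0 i).drift (π i) ≤ 0 := by
    rw [sum_comm]
    exact sum_nonpos fun i _ => sum_drift_stateAt_nonpos st0 i
  have hle : ∑ π : Equiv.Perm (Fin n), ((influenceMIS π st0).card : ℤ)
      ≤ ∑ π : Equiv.Perm (Fin n),
        (st0.potential + ∑ i : Fin n, (stateAt π st0 i).drift (π i)) := by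
    refine sum_le_sum fun π _ => ?_
    have hnonneg : 0 ≤ (stateAt π st0 n).potential := by
      unfold MISState.potential
      positivity
    rw [card_influenceMIS_eq]
    linarith
  rw [sum_add_distrib, sum_const, nsmul_eq_mul, card_univ] at hle
  have hpot : st0.potential = (uV.card : ℤ) + uE.card := rfl
  rw [hpot] at hle
  zify
  linarith
end

section
/- Let G=(V,E) be a finite simple graph, let E_+ be a set of non-edges of G, and run InfluenceMIS on the graph G_all = (V, E ∪ E_+) with initial undecided vertex set V_1^? = ∅ and initial undecided edge set E_1^? ⊆ E ∪ E_+ satisfying E_+ ⊆ E_1^?. Then for the vertex u = π(i): if u ∈ V_i \ V_i^? then u ∈ LFMIS(G,π), and if u ∉ V_i then u ∉ LFMIS(G,π). -/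
open Finset

theorem mem_LFMISOn_univ_iff {n : ℕ} (E : Set (Sym2 (Fin n))) (π : Equiv.Perm (Fin n))
    (v : Fin n) :
    v ∈ LFMISOn Set.univ E π ↔
      ∀ w, π.symm w < π.symm v → s(w, v) ∈ E → w ∉ LFMISOn Set.univ E π := by
  simp only [LFMISOn, Set.mem_univ, true_and, Set.mem_ofPred_eq]
  rw [lfmisAux]
  constructor
  · rintro ⟨-, h⟩ w hlt hE
    exact h _ hlt ⟨(π.symm w).2, (π.symm v).2, trivial, trivial, by simpa using hE⟩
  · intro h
    refine ⟨⟨(π.symm v).2, trivial⟩, ?_⟩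
    rintro j hj ⟨hj', _, _, _, hE⟩
    simpa using h (π ⟨j, hj'⟩) (by simpa [Fin.lt_def] using hj) (by simpa using hE)

/-- What `InfluenceMIS` guarantees at the beginning of iteration `i`, where `E` is the edge set
of the target graph, `F` and `uE` are the initial edge set and the initial undecided edge set,
and `M` is the target independent set. -/
structure InfluenceInvariant {n : ℕ} (E F uE : Finset (Sym2 (Fin n)))
    (π : Equiv.Perm (Fin n)) (M : Set (Fin n)) (i : ℕ) (st : MISState n) : Prop where
  edges_subset : st.edges ⊆ F
  mem_edges : ∀ a ∈ st.verts, ∀ b ∈ st.verts, s(a, b) ∈ F → s(a, b) ∈ st.edges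
  mem_uE : ∀ a ∈ st.verts, ∀ b ∈ st.verts, s(a, b) ∈ uE → s(a, b) ∈ st.uE
  dead : ∀ v, i ≤ (π.symm v : ℕ) → v ∉ st.verts →
    ∃ w ∈ M, (π.symm w : ℕ) < i ∧ s(w, v) ∈ E
  decided : ∀ v ∈ st.verts, v ∉ st.uV → ∀ w ∈ M, (π.symm w : ℕ) < i → s(w, v) ∉ E

namespace InfluenceInvariant

variable {n : ℕ} {E F uE : Finset (Sym2 (Fin n))} {π : Equiv.Perm (Fin n)} {i : ℕ}
  {st : MISState n}

theorem mem_of_decided {M : Set (Fin n)} (h : InfluenceInvariant E F uE π M i st)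
    (hM : M = LFMISOn Set.univ ↑E π) (hi : i < n)
    (hv : π ⟨i, hi⟩ ∈ st.verts) (hu : π ⟨i, hi⟩ ∉ st.uV) : π ⟨i, hi⟩ ∈ M := by
  rw [hM, mem_LFMISOn_univ_iff]
  intro w hw hE hwM
  exact h.decided _ hv hu w (hM ▸ hwM) (by simpa [Fin.lt_def] using hw) (by simpa using hE)

theorem notMem_of_dead {M : Set (Fin n)} (h : InfluenceInvariant E F uE π M i st)
    (hM : M = LFMISOn Set.univ ↑E π) (hi : i < n)
    (hv : π ⟨i, hi⟩ ∉ st.verts) : π ⟨i, hi⟩ ∉ M := by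
  obtain ⟨w, hwM, hw, hE⟩ := h.dead (π ⟨i, hi⟩) (by simp) hv
  rw [hM, mem_LFMISOn_univ_iff]
  intro h'
  exact h' w (by simpa [Fin.lt_def] using hw) (by simpa using hE) (hM ▸ hwM)

theorem step {M : Set (Fin n)} (h : InfluenceInvariant E F uE π M i st)
    (hM : M = LFMISOn Set.univ ↑E π) (hEF : E ⊆ F) (hFE : ∀ e ∈ F, e ∉ uE → e ∈ E)
    (hi : i < n) : InfluenceInvariant E F uE π M (i + 1) (stepInf st (π ⟨i, hi⟩)) := by
  have hmem := h.mem_of_decided hM hi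
  have hnot := h.notMem_of_dead hM hi
  have hpos : ∀ w, (π.symm w : ℕ) = i ↔ w = π ⟨i, hi⟩ := fun w => by
    rw [← Equiv.symm_apply_eq, Fin.ext_iff]
  obtain ⟨he, hme, hmu, hd, hdec⟩ := h
  generalize π ⟨i, hi⟩ = u at *
  unfold stepInf
  split_ifs with huv huU
  · refine ⟨?_, ?_, ?_, ?_, ?_⟩ <;> simp only [MISState.nbrs] <;> grind
  · refine ⟨?_, ?_, ?_, ?_, ?_⟩ <;> simp only [MISState.nbrs] <;> grind
  · refine ⟨he, hme, hmu, ?_, ?_⟩ <;> grind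

theorem stateAt {M : Set (Fin n)} (h : InfluenceInvariant E F uE π M 0 st)
    (hM : M = LFMISOn Set.univ ↑E π) (hEF : E ⊆ F) (hFE : ∀ e ∈ F, e ∉ uE → e ∈ E) :
    ∀ i ≤ n, InfluenceInvariant E F uE π M i (_root_.stateAt π st i)
  | 0, _ => h
  | i + 1, hi => by
    rw [_root_.stateAt, dif_pos (Nat.lt_of_succ_le hi)]
    exact (h.stateAt hM hEF hFE i (by omega)).step hM hEF hFE hi

end InfluenceInvariant

/-- Run `InfluenceMIS` on `G_all = (V, E ∪ E₊)` (where `E₊` is a set of non-edges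
of `G`) with no undecided vertices and with undecided edges `uE ⊇ E₊`.  Then for
the vertex `u = π(i)`: if `u` is alive and decided at the beginning of iteration
`i` then `u ∈ LFMIS(G, π)`, and if `u` is not alive then `u ∉ LFMIS(G, π)`.
(0-based iterations.) -/
theorem alive_decided_in_lfmis {n : ℕ} (G : SimpleGraph (Fin n)) [DecidableRel G.Adj]
    (Eplus : Finset (Sym2 (Fin n)))
    (hEp : ∀ e ∈ Eplus, ¬ e.IsDiag ∧ e ∉ G.edgeFinset)
    (uE : Finset (Sym2 (Fin n))) (h1 : Eplus ⊆ uE) (h2 : uE ⊆ G.edgeFinset ∪ Eplus)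
    (π : Equiv.Perm (Fin n)) (i : ℕ) (hi : i < n) :
    (π ⟨i, hi⟩ ∈ (stateAt π ⟨Finset.univ, G.edgeFinset ∪ Eplus, ∅, uE⟩ i).verts ∧
        π ⟨i, hi⟩ ∉ (stateAt π ⟨Finset.univ, G.edgeFinset ∪ Eplus, ∅, uE⟩ i).uV →
      π ⟨i, hi⟩ ∈ LFMISOn Set.univ ↑G.edgeFinset π) ∧
    (π ⟨i, hi⟩ ∉ (stateAt π ⟨Finset.univ, G.edgeFinset ∪ Eplus, ∅, uE⟩ i).verts →
      π ⟨i, hi⟩ ∉ LFMISOn Set.univ ↑G.edgeFinset π) := by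
  have hinv : InfluenceInvariant G.edgeFinset (G.edgeFinset ∪ Eplus) uE π
      (LFMISOn Set.univ ↑G.edgeFinset π) 0 ⟨Finset.univ, G.edgeFinset ∪ Eplus, ∅, uE⟩ := by
    constructor <;> simp
  have hst := hinv.stateAt rfl subset_union_left
    (fun e he hu => (mem_union.1 he).resolve_right fun h => hu (h1 h)) i hi.le
  exact ⟨fun h => hst.mem_of_decided rfl hi h.1 h.2, hst.notMem_of_dead rfl hi⟩
end
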